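/- arXiv:1310.3855 — 7 statements merged into one kernel-verified Lean document; each statement's English description precedes it below -/
import Mathlib

section
/- Let P = (P_{ij}) ∈ M_M(M_N(ℂ)) be a submagic matrix all of whose entries are rank-one orthogonal projections. Then the entries P_{ij} pairwise commute if and only if there exist an orthogonal basis ξ_1,…,ξ_N of ℂ^N and a pre-Latin square L ∈ M_M({1,…,N}) such that P_{ij} = Proj(ξ_{L_{ij}}) for all i, j. -/
open Matrix

/-- The orthogonal projection onto the line `ℂξ`, with entries
`Proj(ξ)_{kl} = ξ_k · conj(ξ_l) / ‖ξ‖²`. -/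
noncomputable def proj {N : ℕ} (ξ : Fin N → ℂ) : Matrix (Fin N) (Fin N) ℂ :=
  Matrix.of fun k l => ξ k * (starRingEnd ℂ) (ξ l) / ((∑ m, Complex.normSq (ξ m) : ℝ) : ℂ)


lemma aux_exists_unit {N : ℕ} (Q : Matrix (Fin N) (Fin N) ℂ)
    (h1 : Q * Q = Q) (h2 : Qᴴ = Q) (h3 : Q.rank = 1) :
    ∃ v : EuclideanSpace ℂ (Fin N), ∑ m, v m * (starRingEnd ℂ) (v m) = 1 ∧
      ∀ k l, Q k l = v k * (starRingEnd ℂ) (v l) := by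
  have hH : ∀ k l, (starRingEnd ℂ) (Q k l) = Q l k := fun k l => by
    have := congrFun (congrFun h2 l) k
    simpa [Matrix.conjTranspose_apply] using this
  -- factorization
  obtain ⟨u, hu0, hu⟩ := finrank_eq_one_iff'.1 (h3 : Module.finrank ℂ _ = 1)
  have hc : ∀ l, ∃ c : ℂ, ∀ k, Q k l = c * u.1 k := by
    intro l
    obtain ⟨c, hc⟩ := hu ⟨Q.mulVecLin (Pi.single l 1), ⟨_, rfl⟩⟩
    refine ⟨c, fun k => ?_⟩
    have := congrFun (congrArg Subtype.val hc) k
    simpa using this.symm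
  choose c hc using hc
  have hQ0 : Q ≠ 0 := by rintro rfl; simp at h3
  obtain ⟨a, ha⟩ : ∃ a, Q a a ≠ 0 := by
    by_contra! hcon
    apply hQ0
    ext k l
    have e : Q k l * Q l k = Q k k * Q l l := by
      rw [hc l k, hc k l, hc k k, hc l l]; ring
    rw [hcon, ← hH k l, Complex.mul_conj] at e
    simpa using e
  have hf : ∀ k l, Q k l * Q a a = Q k a * (starRingEnd ℂ) (Q l a) := by
    intro k l
    rw [hH, hc l k, hc a a, hc a k, hc l a]; ring
  have hs : Q a a = ((∑ m, Complex.normSq (Q m a) : ℝ) : ℂ) := by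
    conv_lhs => rw [← h1, Matrix.mul_apply]
    push_cast
    refine Finset.sum_congr rfl fun m _ => ?_
    rw [← hH m a, mul_comm, Complex.mul_conj]
  set t : ℝ := ∑ m, Complex.normSq (Q m a) with ht
  have ht0 : 0 ≤ t := Finset.sum_nonneg fun m _ => Complex.normSq_nonneg _
  have ht1 : (t : ℂ) ≠ 0 := hs ▸ ha
  have hsq : ((Real.sqrt t : ℝ) : ℂ) * ((Real.sqrt t : ℝ) : ℂ) = t := by
    rw [← Complex.ofReal_mul, Real.mul_self_sqrt ht0]
  have hr : ((Real.sqrt t : ℝ) : ℂ) ≠ 0 := by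
    intro h; rw [h] at hsq; simp at hsq; exact ht1 (by simp [← hsq])
  have key : ∀ k l, Q k l = (Q k a / (Real.sqrt t : ℝ)) *
      (starRingEnd ℂ) (Q l a / (Real.sqrt t : ℝ)) := by
    intro k l
    rw [map_div₀, Complex.conj_ofReal, div_mul_div_comm, hsq, ← hf, hs, mul_div_cancel_right₀ _ ht1]
  refine ⟨WithLp.toLp 2 fun k => Q k a / (Real.sqrt t : ℝ), ?_, key⟩
  show ∑ m, (Q m a / (Real.sqrt t : ℝ)) * (starRingEnd ℂ) (Q m a / (Real.sqrt t : ℝ)) = 1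
  have : ∀ m, (Q m a / (Real.sqrt t : ℝ)) * (starRingEnd ℂ) (Q m a / (Real.sqrt t : ℝ))
      = (Complex.normSq (Q m a) : ℂ) / t := by
    intro m
    rw [map_div₀, Complex.conj_ofReal, div_mul_div_comm, hsq, Complex.mul_conj]
  rw [Finset.sum_congr rfl fun m _ => this m, ← Finset.sum_div, ← Complex.ofReal_sum, ← ht,
    div_self ht1]

lemma aux_proj {N : ℕ} (v : Fin N → ℂ) (h : ∑ m, v m * (starRingEnd ℂ) (v m) = 1) (k l : Fin N) :
    proj v k l = v k * (starRingEnd ℂ) (v l) := by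
  have : ((∑ m, Complex.normSq (v m) : ℝ) : ℂ) = 1 := by
    rw [← h]; push_cast; simp [Complex.mul_conj]
  simp only [proj, Matrix.of_apply, this, div_one]

lemma aux_commute {N : ℕ} (P Q : Matrix (Fin N) (Fin N) ℂ) (v w : Fin N → ℂ)
    (hv1 : ∑ m, v m * (starRingEnd ℂ) (v m) = 1) (hw1 : ∑ m, w m * (starRingEnd ℂ) (w m) = 1)
    (hP : ∀ k l, P k l = v k * (starRingEnd ℂ) (v l))
    (hQ : ∀ k l, Q k l = w k * (starRingEnd ℂ) (w l))
    (hc : P * Q = Q * P) (hne : P ≠ Q) : ∑ m, w m * (starRingEnd ℂ) (v m) = 0 := by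
  by_contra hs
  set s := ∑ m, w m * (starRingEnd ℂ) (v m) with hsd
  have hs' : ∑ m, v m * (starRingEnd ℂ) (w m) = (starRingEnd ℂ) s := by
    simp [hsd, mul_comm]
  have h1 : ∀ k l, s * (v k * (starRingEnd ℂ) (w l)) =
      (starRingEnd ℂ) s * (w k * (starRingEnd ℂ) (v l)) := by
    intro k l
    have := congrFun (congrFun hc k) l
    simp only [Matrix.mul_apply, hP, hQ] at this
    rw [hsd, ← hsd, ← hs', hsd, Finset.sum_mul, Finset.sum_mul]
    convert this using 2 <;> ring
  have h2 : ∀ k, v k = (starRingEnd ℂ) s * w k := by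
    intro k
    apply mul_left_cancel₀ hs
    calc s * v k = ∑ l, (s * (v k * (starRingEnd ℂ) (w l))) * w l := by
          rw [← mul_one (s * v k), ← hw1, Finset.mul_sum]
          exact Finset.sum_congr rfl fun l _ => by ring
      _ = ∑ l, ((starRingEnd ℂ) s * (w k * (starRingEnd ℂ) (v l))) * w l :=
          Finset.sum_congr rfl fun l _ => by rw [h1]
      _ = (starRingEnd ℂ) s * w k * s := by
          conv_rhs => rw [hsd, ← hsd]
          rw [hsd, Finset.mul_sum]
          exact Finset.sum_congr rfl fun l _ => by ring
      _ = _ := by ring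
  have h3 : (starRingEnd ℂ) s * s = 1 := by
    rw [← hv1, ← mul_one ((starRingEnd ℂ) s * s), ← hw1, Finset.mul_sum]
    refine Finset.sum_congr rfl fun l _ => ?_
    rw [h2]; simp; ring
  apply hne
  ext k l
  rw [hP, hQ, h2 k, h2 l, map_mul, Complex.conj_conj]
  linear_combination (w k * (starRingEnd ℂ) (w l)) * h3

lemma aux_proj_mul {N : ℕ} (v w : Fin N → ℂ) (h : ∑ m, w m * (starRingEnd ℂ) (v m) = 0) :
    proj v * proj w = 0 := by
  ext k l
  simp only [Matrix.mul_apply, proj, Matrix.of_apply, Matrix.zero_apply]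
  set A : ℂ := ((∑ m, Complex.normSq (v m) : ℝ) : ℂ)
  set B : ℂ := ((∑ m, Complex.normSq (w m) : ℝ) : ℂ)
  calc _ = ∑ m, (v k * (starRingEnd ℂ) (w l) / A / B) * (w m * (starRingEnd ℂ) (v m)) :=
        Finset.sum_congr rfl fun m _ => by ring
    _ = 0 := by rw [← Finset.mul_sum, h, mul_zero]

/-- For a submagic matrix `P ∈ M_M(M_N(ℂ))` formed of rank-one orthogonal projections,
the entries pairwise commute iff `P` comes from a pre-Latin square: there are an
orthogonal basis `ξ_1,…,ξ_N` of `ℂ^N` and a pre-Latin square `L ∈ M_M({1,…,N})`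
(entries distinct on each row and column) with `P_{ij} = Proj(ξ_{L_{ij}})`. -/
theorem submagic_rank_one_commute_iff_preLatin (M N : ℕ)
    (P : Fin M → Fin M → Matrix (Fin N) (Fin N) ℂ)
    (hproj : ∀ i j, P i j * P i j = P i j ∧ (P i j)ᴴ = P i j ∧ (P i j).rank = 1)
    (hrow : ∀ i j k, j ≠ k → P i j * P i k = 0)
    (hcol : ∀ i j k, i ≠ k → P i j * P k j = 0) :
    (∀ i j k l, P i j * P k l = P k l * P i j) ↔
      ∃ ξ : Fin N → Fin N → ℂ,
        (∀ a, ξ a ≠ 0) ∧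
        (∀ a b, a ≠ b → ∑ m, ξ a m * (starRingEnd ℂ) (ξ b m) = 0) ∧
        ∃ L : Fin M → Fin M → Fin N,
          (∀ i, Function.Injective (fun j => L i j)) ∧
          (∀ j, Function.Injective (fun i => L i j)) ∧
          ∀ i j, P i j = proj (ξ (L i j)) := by
  have hne : ∀ i j, P i j * P i j ≠ 0 := by
    intro i j h
    obtain ⟨h1, -, h3⟩ := hproj i j
    rw [h1] at h
    rw [h] at h3
    simp at h3
  constructor
  · intro hcomm
    have hV : ∀ Q : Set.range (fun p : Fin M × Fin M => P p.1 p.2),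
        ∃ v : EuclideanSpace ℂ (Fin N), ∑ m, v m * (starRingEnd ℂ) (v m) = 1 ∧
          ∀ k l, Q.1 k l = v k * (starRingEnd ℂ) (v l) := by
      rintro ⟨_, ⟨⟨i, j⟩, rfl⟩⟩
      obtain ⟨h1, h2, h3⟩ := hproj i j
      exact aux_exists_unit _ h1 h2 h3
    choose V hV1 hV2 using hV
    have hinner : ∀ x y : EuclideanSpace ℂ (Fin N),
        inner ℂ x y = ∑ m, y m * (starRingEnd ℂ) (x m) := by
      intro x y
      simp [PiLp.inner_apply]
    have hon : Orthonormal ℂ V := by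
      refine ⟨fun Q => ?_, ?_⟩
      · have h := hV1 Q
        rw [← hinner, inner_self_eq_norm_sq_to_K] at h
        have h' : ‖V Q‖ ^ 2 = 1 := Complex.ofReal_injective (by push_cast; exact h)
        nlinarith [norm_nonneg (V Q), (pow_eq_one_iff_of_nonneg (norm_nonneg (V Q)) two_ne_zero).1 h']
      · intro Q R hQR
        show inner ℂ (V Q) (V R) = 0
        rw [hinner]
        refine aux_commute Q.1 R.1 _ _ (hV1 Q) (hV1 R) (hV2 Q) (hV2 R) ?_
          (fun h => hQR (Subtype.ext h))
        obtain ⟨_, ⟨⟨i, j⟩, rfl⟩⟩ := Q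
        obtain ⟨_, ⟨⟨k, l⟩, rfl⟩⟩ := R
        exact hcomm i j k l
    obtain ⟨u, b, hu, hb⟩ := hon.toSubtypeRange.exists_orthonormalBasis_extension
    have hcard : Fintype.card u = Fintype.card (Fin N) := by
      rw [← Module.finrank_eq_card_basis b.toBasis]; simp
    let e := Fintype.equivOfCardEq hcard
    let c := b.reindex e
    have hL : ∀ i j, ∃ a : Fin N, c a = V ⟨P i j, ⟨(i, j), rfl⟩⟩ := by
      intro i j
      refine ⟨e ⟨V ⟨P i j, ⟨(i, j), rfl⟩⟩, hu ⟨_, rfl⟩⟩, ?_⟩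
      simp [c, hb]
    choose L hL using hL
    have hP : ∀ i j, P i j = proj (fun m => c (L i j) m) := by
      intro i j
      ext k l
      rw [hL, aux_proj _ (hV1 _)]
      exact hV2 ⟨P i j, ⟨(i, j), rfl⟩⟩ k l
    refine ⟨fun a m => c a m, ?_, ?_, L, ?_, ?_, hP⟩
    · intro a h
      apply c.orthonormal.ne_zero a
      ext m
      exact congrFun h m
    · intro a b hab
      rw [← hinner]
      exact c.inner_eq_zero hab.symm
    · intro i j k hjk
      by_contra hh
      have hjk : L i j = L i k := hjk
      have := hrow i j k hh
      rw [hP i j, hP i k, hjk, ← hP i k] at this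
      exact hne _ _ this
    · intro j i k hik
      by_contra hh
      have hik : L i j = L k j := hik
      have := hcol i j k hh
      rw [hP i j, hP k j, hik, ← hP k j] at this
      exact hne _ _ this
  · rintro ⟨ξ, -, horth, L, -, -, hP⟩ i j k l
    rw [hP i j, hP k l]
    by_cases h : L i j = L k l
    · rw [h]
    · rw [aux_proj_mul _ _ (horth _ _ (Ne.symm h)), aux_proj_mul _ _ (horth _ _ h)]
end

section
/- Let A be a unital C*-algebra and let P = (P_{ij}) ∈ M_{N-1}(A) be a submagic matrix. Then the following are equivalent: (1) P can be completed to a magic matrix P̃ ∈ M_N(A) whose upper-left (N-1)×(N-1) block is P; (2) the projections P_{iN} := 1 - ∑_{j=1}^{N-1} P_{ij} (i = 1,…,N-1) satisfy P_{iN}·P_{kN} = 0 for all i ≠ k; (3) the projections P_{Nj} := 1 - ∑_{i=1}^{N-1} P_{ij} (j = 1,…,N-1) satisfy P_{Nj}·P_{Nl} = 0 for all j ≠ l; (4) the element P_{NN} := (∑_{i,j=1}^{N-1} P_{ij}) - (N-2)·1 is a projection (self-adjoint idempotent). -/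
/-- A matrix over a `*`-ring is submagic if all entries are projections, pairwise
orthogonal on each row and each column. -/
def IsSubmagic {A : Type*} [Ring A] [StarRing A] {M : ℕ}
    (u : Matrix (Fin M) (Fin M) A) : Prop :=
  (∀ i j, u i j * u i j = u i j) ∧ (∀ i j, star (u i j) = u i j) ∧
  (∀ i j k, j ≠ k → u i j * u i k = 0) ∧
  (∀ i j k, i ≠ k → u i j * u k j = 0)

/-- A matrix over a `*`-ring is magic if it is submagic and all rows and columns
sum to `1`. -/
def IsMagic {A : Type*} [Ring A] [StarRing A] {M : ℕ}
    (u : Matrix (Fin M) (Fin M) A) : Prop :=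
  IsSubmagic u ∧ (∀ i, ∑ j, u i j = 1) ∧ (∀ j, ∑ i, u i j = 1)

/-- If a sum of squares `star x * x` vanishes, so does each term. -/
theorem aux_sum_star_mul {A : Type*} [NormedRing A] [StarRing A]
    [CStarRing A] [CompleteSpace A] [NormedAlgebra ℂ A] [StarModule ℂ A]
    {ι : Type*} (s : Finset ι) (x : ι → A) (y : A)
    (h : star y * y + ∑ i ∈ s, star (x i) * x i = 0) : ∀ i ∈ s, x i = 0 := by
  letI : CStarAlgebra A := {}
  letI : PartialOrder A := CStarAlgebra.spectralOrder A
  haveI : StarOrderedRing A := CStarAlgebra.spectralOrderedRing A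
  have h1 : ∀ i ∈ s, 0 ≤ star (x i) * x i := fun i _ => star_mul_self_nonneg (x i)
  have h2 : ∑ i ∈ s, star (x i) * x i = 0 :=
    ((add_eq_zero_iff_of_nonneg (star_mul_self_nonneg y) (Finset.sum_nonneg h1)).1 h).2
  intro i hi
  exact (CStarRing.star_mul_self_eq_zero_iff (x i)).1
    ((Finset.sum_eq_zero_iff_of_nonneg h1).1 h2 i hi)

/-- A sum of pairwise orthogonal idempotents: product with a summand. -/
theorem aux_mul_sum {A : Type*} [Ring A] {n : ℕ} (r : Fin n → A)
    (h1 : ∀ i, r i * r i = r i) (h3 : ∀ i k, i ≠ k → r i * r k = 0) (i : Fin n) :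
    r i * ∑ k, r k = r i := by
  rw [Finset.mul_sum, Finset.sum_eq_single i]
  · exact h1 i
  · intro b _ hb
    exact h3 i b hb.symm
  · simp

theorem aux_sum_mul {A : Type*} [Ring A] {n : ℕ} (r : Fin n → A)
    (h1 : ∀ i, r i * r i = r i) (h3 : ∀ i k, i ≠ k → r i * r k = 0) (i : Fin n) :
    (∑ k, r k) * r i = r i := by
  rw [Finset.sum_mul, Finset.sum_eq_single i]
  · exact h1 i
  · intro b _ hb
    exact h3 b i hb
  · simp

theorem aux_sum_idem {A : Type*} [Ring A] {n : ℕ} (r : Fin n → A)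
    (h1 : ∀ i, r i * r i = r i) (h3 : ∀ i k, i ≠ k → r i * r k = 0) :
    (∑ k, r k) * ∑ k, r k = ∑ k, r k := by
  rw [Finset.sum_mul]
  exact Finset.sum_congr rfl fun i _ => aux_mul_sum r h1 h3 i

/-- Projections with `1 - ∑ r` a projection are pairwise orthogonal. -/
theorem aux_orth {A : Type*} [NormedRing A] [StarRing A]
    [CStarRing A] [CompleteSpace A] [NormedAlgebra ℂ A] [StarModule ℂ A]
    {n : ℕ} (r : Fin n → A)
    (h1 : ∀ i, r i * r i = r i) (h2 : ∀ i, star (r i) = r i) (p : A)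
    (hp : p = 1 - ∑ i, r i) (hp1 : p * p = p) (hp2 : star p = p) :
    ∀ i k, i ≠ k → r i * r k = 0 := by
  intro i k hik
  refine aux_sum_star_mul (Finset.univ.erase k) (fun i => r i * r k) (p * r k) ?_ i
    (by simp [hik])
  have e1 : ∀ i, star (r i * r k) * (r i * r k) = r k * r i * r k := by
    intro i
    rw [star_mul, h2, h2, mul_assoc, ← mul_assoc (r i), h1, mul_assoc]
  have e2 : star (p * r k) * (p * r k) = r k * p * r k := by
    rw [star_mul, h2, hp2, mul_assoc, ← mul_assoc p, hp1, mul_assoc]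
  simp only [e1, e2]
  have e3 : ∑ i, r k * r i * r k = r k * (∑ i, r i) * r k := by
    rw [Finset.mul_sum, Finset.sum_mul]
  rw [← Finset.add_sum_erase _ _ (Finset.mem_univ k), h1, h1] at e3
  rw [hp, mul_sub, sub_mul, ← e3, mul_one, h1]
  abel

theorem aux_compl {A : Type*} [Ring A] [StarRing A] {n : ℕ} (r : Fin n → A)
    (h1 : ∀ i, r i * r i = r i) (h2 : ∀ i, star (r i) = r i)
    (h3 : ∀ i k, i ≠ k → r i * r k = 0) :
    (1 - ∑ i, r i) * (1 - ∑ i, r i) = 1 - ∑ i, r i ∧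
      star (1 - ∑ i, r i) = 1 - ∑ i, r i := by
  constructor
  · have h := aux_sum_idem r h1 h3
    rw [mul_sub, mul_one, sub_mul, one_mul, h, sub_self, sub_zero]
  · simp [h2]

/-- For a submagic matrix `P ∈ M_n(A)` over a unital C*-algebra, TFAE:
(1) `P` completes to a magic matrix in `M_{n+1}(A)`;
(2) the projections `P_{i,n+1} = 1 - ∑_j P_{ij}` are pairwise orthogonal;
(3) the projections `P_{n+1,j} = 1 - ∑_i P_{ij}` are pairwise orthogonal;
(4) the element `(∑_{ij} P_{ij}) - (n+1) + 2` is a projection. -/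
theorem submagic_completion_tfae (n : ℕ) {A : Type*} [NormedRing A] [StarRing A]
    [CStarRing A] [CompleteSpace A] [NormedAlgebra ℂ A] [StarModule ℂ A]
    (P : Matrix (Fin n) (Fin n) A) (hP : IsSubmagic P) :
    List.TFAE [
      (∃ Q : Matrix (Fin (n + 1)) (Fin (n + 1)) A, IsMagic Q ∧
        ∀ i j : Fin n, Q i.castSucc j.castSucc = P i j),
      (∀ i k : Fin n, i ≠ k → (1 - ∑ j, P i j) * (1 - ∑ j, P k j) = 0),
      (∀ j l : Fin n, j ≠ l → (1 - ∑ i, P i j) * (1 - ∑ i, P i l) = 0),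
      (((∑ i, ∑ j, P i j) - ((n : A) + 1) + 2) * ((∑ i, ∑ j, P i j) - ((n : A) + 1) + 2) =
          (∑ i, ∑ j, P i j) - ((n : A) + 1) + 2 ∧
        star ((∑ i, ∑ j, P i j) - ((n : A) + 1) + 2) =
          (∑ i, ∑ j, P i j) - ((n : A) + 1) + 2)] := by
  obtain ⟨p1, p2, p3, p4⟩ := hP
  have hr := fun i => aux_compl (fun j => P i j) (p1 i) (p2 i) (p3 i)
  have hc := fun j => aux_compl (fun i => P i j) (fun i => p1 i j) (fun i => p2 i j)
    (fun i k h => p4 i j k h)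
  have er : (∑ i, ∑ j, P i j) - ((n : A) + 1) + 2 = 1 - ∑ i, (1 - ∑ j, P i j) := by
    rw [Finset.sum_sub_distrib, ← one_add_one_eq_two]
    simp only [Finset.sum_const, Finset.card_univ, Fintype.card_fin, nsmul_eq_mul, mul_one]
    abel
  have ec : (∑ i, ∑ j, P i j) - ((n : A) + 1) + 2 = 1 - ∑ j, (1 - ∑ i, P i j) := by
    rw [Finset.sum_sub_distrib, ← one_add_one_eq_two, Finset.sum_comm]
    simp only [Finset.sum_const, Finset.card_univ, Fintype.card_fin, nsmul_eq_mul, mul_one]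
    abel
  tfae_have 2 → 4 := by
    intro h
    rw [er]
    exact aux_compl (fun i => 1 - ∑ j, P i j) (fun i => (hr i).1) (fun i => (hr i).2) h
  tfae_have 3 → 4 := by
    intro h
    rw [ec]
    exact aux_compl (fun j => 1 - ∑ i, P i j) (fun i => (hc i).1) (fun i => (hc i).2) h
  tfae_have 4 → 2 := fun h =>
    aux_orth (fun i => 1 - ∑ j, P i j) (fun i => (hr i).1) (fun i => (hr i).2) _ er h.1 h.2
  tfae_have 4 → 3 := fun h =>
    aux_orth (fun j => 1 - ∑ i, P i j) (fun i => (hc i).1) (fun i => (hc i).2) _ ec h.1 h.2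
  tfae_have 1 → 2 := by
    rintro ⟨Q, ⟨⟨_, _, _, q4⟩, q5, _⟩, hQ⟩ i k hik
    have e : ∀ i : Fin n, 1 - ∑ j, P i j = Q i.castSucc (Fin.last n) := by
      intro i
      rw [← q5 i.castSucc, Fin.sum_univ_castSucc]
      simp [hQ]
    rw [e, e]
    exact q4 _ _ _ (by simpa using hik)
  tfae_have 4 → 1 := by
    intro h
    have hR := tfae_4_to_2 h
    have hC := tfae_4_to_3 h
    generalize (∑ i, ∑ j, P i j) - ((n : A) + 1) + 2 = p at er ec h
    have rp := fun i => aux_mul_sum (fun i => 1 - ∑ j, P i j) (fun i => (hr i).1) hR i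
    have pr := fun i => aux_sum_mul (fun i => 1 - ∑ j, P i j) (fun i => (hr i).1) hR i
    have cp := fun i => aux_mul_sum (fun j => 1 - ∑ i, P i j) (fun i => (hc i).1) hC i
    have pc := fun i => aux_sum_mul (fun j => 1 - ∑ i, P i j) (fun i => (hc i).1) hC i
    have a1 := fun i j => aux_mul_sum (fun j => P i j) (p1 i) (p3 i) j
    have a2 := fun i j => aux_sum_mul (fun j => P i j) (p1 i) (p3 i) j
    have a3 := fun i j => aux_mul_sum (fun i => P i j) (fun i => p1 i j)
      (fun i k h => p4 i j k h) i
    have a4 := fun i j => aux_sum_mul (fun i => P i j) (fun i => p1 i j)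
      (fun i k h => p4 i j k h) i
    have rp' : ∀ i, (1 - ∑ j, P i j) * p = 0 := by
      intro i; rw [er, mul_sub, mul_one, rp i, sub_self]
    have pr' : ∀ i, p * (1 - ∑ j, P i j) = 0 := by
      intro i; rw [er, sub_mul, one_mul, pr i, sub_self]
    have cp' : ∀ j, (1 - ∑ i, P i j) * p = 0 := by
      intro i; rw [ec, mul_sub, mul_one, cp i, sub_self]
    have pc' : ∀ j, p * (1 - ∑ i, P i j) = 0 := by
      intro i; rw [ec, sub_mul, one_mul, pc i, sub_self]
    have b1 : ∀ i j, P i j * (1 - ∑ j, P i j) = 0 := by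
      intro i j; rw [mul_sub, mul_one, a1 i j, sub_self]
    have b2 : ∀ i j, (1 - ∑ j, P i j) * P i j = 0 := by
      intro i j; rw [sub_mul, one_mul, a2 i j, sub_self]
    have b3 : ∀ i j, P i j * (1 - ∑ i, P i j) = 0 := by
      intro i j; rw [mul_sub, mul_one, a3 i j, sub_self]
    have b4 : ∀ i j, (1 - ∑ i, P i j) * P i j = 0 := by
      intro i j; rw [sub_mul, one_mul, a4 i j, sub_self]
    have sr : ∑ i, (1 - ∑ j, P i j) + p = 1 := by rw [er]; abel
    have sc : ∑ j, (1 - ∑ i, P i j) + p = 1 := by rw [ec]; abel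
    have hr1 := fun i => (hr i).1
    have hr2 := fun i => (hr i).2
    have hc1 := fun i => (hc i).1
    have hc2 := fun i => (hc i).2
    have sr' : ∀ i, ∑ j, P i j + (1 - ∑ j, P i j) = 1 := fun i => by abel
    have sc' : ∀ j, ∑ i, P i j + (1 - ∑ i, P i j) = 1 := fun i => by abel
    obtain ⟨h1, h2⟩ := h
    generalize hrd : (fun i => 1 - ∑ j, P i j) = r at *
    generalize hcd : (fun j => 1 - ∑ i, P i j) = c at *
    have hrd' : ∀ i, 1 - ∑ j, P i j = r i := fun i => congrFun hrd i
    have hcd' : ∀ i, 1 - ∑ j, P j i = c i := fun i => congrFun hcd i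
    simp only [hrd', hcd'] at hR hC rp' pr' cp' pc' b1 b2 b3 b4 sr sc hr1 hr2 hc1 hc2 sr' sc'
    let Q : Matrix (Fin (n + 1)) (Fin (n + 1)) A := fun i j =>
      Fin.lastCases (motive := fun _ => A)
        (Fin.lastCases (motive := fun _ => A) p c j)
        (fun i => Fin.lastCases (motive := fun _ => A) (r i) (fun j => P i j) j) i
    have Q1 : Q (Fin.last n) (Fin.last n) = p := by simp [Q]
    have Q2 : ∀ j, Q (Fin.last n) (Fin.castSucc j) = c j := by simp [Q]
    have Q3 : ∀ i, Q (Fin.castSucc i) (Fin.last n) = r i := by simp [Q]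
    have Q4 : ∀ i j, Q (Fin.castSucc i) (Fin.castSucc j) = P i j := by simp [Q]
    refine ⟨Q, ⟨⟨?_, ?_, ?_, ?_⟩, ?_, ?_⟩, Q4⟩
    · intro i j
      induction i using Fin.lastCases <;> induction j using Fin.lastCases <;>
        simp only [Q1, Q2, Q3, Q4, h1, hr1, hc1, p1]
    · intro i j
      induction i using Fin.lastCases <;> induction j using Fin.lastCases <;>
        simp only [Q1, Q2, Q3, Q4, h2, hr2, hc2, p2]
    · intro i j k hjk
      induction i using Fin.lastCases <;> induction j using Fin.lastCases <;>
        induction k using Fin.lastCases <;>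
        first
        | exact absurd rfl hjk
        | (simp only [Q1, Q2, Q3, Q4, cp', pc', b1, b2]; done)
        | (simp only [Q2, Q4]
           first
           | exact hC _ _ (fun e => hjk (congrArg _ e))
           | exact p3 _ _ _ (fun e => hjk (congrArg _ e)))
    · intro i j k hik
      induction j using Fin.lastCases <;> induction i using Fin.lastCases <;>
        induction k using Fin.lastCases <;>
        first
        | exact absurd rfl hik
        | (simp only [Q1, Q2, Q3, Q4, rp', pr', b3, b4]; done)
        | (simp only [Q3, Q4]
           first
           | exact hR _ _ (fun e => hik (congrArg _ e))
           | exact p4 _ _ _ (fun e => hik (congrArg _ e)))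
    · intro i
      rw [Fin.sum_univ_castSucc]
      induction i using Fin.lastCases <;> simp only [Q1, Q2, Q3, Q4, sc, sr']
    · intro i
      rw [Fin.sum_univ_castSucc]
      induction i using Fin.lastCases <;> simp only [Q1, Q2, Q3, Q4, sr, sc']
  tfae_finish
end

section
/- Let A be a unital C*-algebra, let P = (P_{ij}) ∈ M_M(A) be a submagic matrix, and set N = M + K. If P can be completed to a magic matrix P̃ ∈ M_N(A) whose upper-left M×M block is P, then ∑_{i,j=1}^{M} P_{ij} ≥ (M - K)·1 in the order of self-adjoint elements of A. -/
/-- If a submagic matrix `P ∈ M_M(A)` over a unital C*-algebra completes to a magic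
matrix in `M_{M+K}(A)`, then `∑_{ij} P_{ij} ≥ (M - K)·1` in the order on self-adjoint
elements. -/
theorem submagic_completion_necessary (M K : ℕ) {A : Type*} [NormedRing A]
    [StarRing A] [CStarRing A] [CompleteSpace A] [NormedAlgebra ℂ A] [StarModule ℂ A]
    [PartialOrder A] [StarOrderedRing A]
    (P : Matrix (Fin M) (Fin M) A) (hP : IsSubmagic P)
    (h : ∃ Q : Matrix (Fin (M + K)) (Fin (M + K)) A, IsMagic Q ∧
      ∀ i j : Fin M, Q (Fin.castAdd K i) (Fin.castAdd K j) = P i j) :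
    (M : A) - (K : A) ≤ ∑ i, ∑ j, P i j := by
  obtain ⟨Q, ⟨⟨hidem, hstar, -, -⟩, hrow, hcol⟩, hQ⟩ := h
  have h1 : ∑ i, ∑ j, P i j + ∑ i : Fin M, ∑ k : Fin K, Q (Fin.castAdd K i) (Fin.natAdd M k)
      = (M : A) := by
    rw [← Finset.sum_add_distrib]
    have : ∀ i : Fin M, ∑ j, P i j + ∑ k : Fin K, Q (Fin.castAdd K i) (Fin.natAdd M k) = 1 := by
      intro i
      rw [← hrow (Fin.castAdd K i), Fin.sum_univ_add]
      simp [hQ]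
    simp [this]
  have h2 : ∑ i : Fin M, ∑ k : Fin K, Q (Fin.castAdd K i) (Fin.natAdd M k)
      + ∑ k : Fin K, ∑ l : Fin K, Q (Fin.natAdd M l) (Fin.natAdd M k) = (K : A) := by
    rw [Finset.sum_comm, ← Finset.sum_add_distrib]
    have : ∀ k : Fin K, ∑ i : Fin M, Q (Fin.castAdd K i) (Fin.natAdd M k)
        + ∑ l : Fin K, Q (Fin.natAdd M l) (Fin.natAdd M k) = 1 := by
      intro k
      rw [← hcol (Fin.natAdd M k), Fin.sum_univ_add]
    simp [this]
  have h3 : 0 ≤ ∑ k : Fin K, ∑ l : Fin K, Q (Fin.natAdd M l) (Fin.natAdd M k) := by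
    refine Finset.sum_nonneg fun k _ => Finset.sum_nonneg fun l _ => ?_
    have := star_mul_self_nonneg (Q (Fin.natAdd M l) (Fin.natAdd M k))
    rwa [hstar, hidem] at this
  rw [← sub_nonneg, ← h1, ← h2]
  convert h3 using 1
  abel
end

section
/- Let X be a compact Hausdorff topological space, let P = (P_{ij}) ∈ M_M(C(X,ℂ)) be a submagic matrix (so each P_{ij} is a continuous {0,1}-valued function), and set N = M + K. Then the following are equivalent: (1) P can be completed to a magic matrix P̃ ∈ M_N(C(X,ℂ)) whose upper-left M×M block is P; (2) for every x ∈ X, the number of pairs (i,j) with P_{ij}(x) = 1 is at least M - K, i.e., ∑_{i,j=1}^{M} P_{ij}(x) ≥ M - K. -/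
open Classical in
/-- Any partial permutation pattern with at most `K` empty rows extends to a permutation. -/
lemma exists_perm_of_pattern (M K : ℕ) (s : Fin M → Fin M → Prop)
    (hr : ∀ i j k, s i j → s i k → j = k) (hc : ∀ i j k, s i j → s k j → i = k)
    (hK : (Finset.univ.filter (fun i => ¬ ∃ j, s i j)).card ≤ K) :
    ∃ σ : Equiv.Perm (Fin (M + K)), ∀ i j, σ (Fin.castAdd K i) = Fin.castAdd K j ↔ s i j := by
  have hcard : Fintype.card {i : Fin M // ¬ ∃ j, s i j} ≤ Fintype.card (Fin K) := by
    rw [Fintype.card_subtype, Fintype.card_fin]; exact hK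
  obtain ⟨g⟩ := Function.Embedding.nonempty_of_card_le hcard
  let f : Fin M → Fin (M + K) := fun i =>
    if h : ∃ j, s i j then Fin.castAdd K h.choose else Fin.natAdd M (g ⟨i, h⟩)
  have hne : ∀ (a : Fin M) (b : Fin K), Fin.castAdd K a ≠ Fin.natAdd M b := by
    intro a b h
    have := congrArg Fin.val h
    simp at this
    omega
  have hf : ∀ i j, f i = Fin.castAdd K j ↔ s i j := by
    intro i j
    by_cases h : ∃ j, s i j
    · simp only [f, dif_pos h]
      constructor
      · intro e
        have := Fin.castAdd_injective M K e
        rw [← this]; exact h.choose_spec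
      · intro e
        rw [hr i _ _ h.choose_spec e]
    · simp only [f, dif_neg h]
      constructor
      · intro e; exact absurd e.symm (hne _ _)
      · intro e; exact absurd ⟨j, e⟩ h
  have hfi : Function.Injective f := by
    intro a b hab
    by_cases ha : ∃ j, s a j
    · obtain ⟨j, hj⟩ := ha
      have h1 := (hf a j).2 hj
      exact hc a j b hj ((hf b j).1 (hab ▸ h1))
    · by_cases hb : ∃ j, s b j
      · obtain ⟨j, hj⟩ := hb
        have h1 := (hf b j).2 hj
        exact hc a j b ((hf a j).1 (hab.trans h1)) hj
      · simp only [f, dif_neg ha, dif_neg hb] at hab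
        have := g.injective (Fin.natAdd_injective K M hab)
        exact congrArg Subtype.val this
  let e0 : {x // x ∈ Set.range (Fin.castAdd K : Fin M → Fin (M + K))} ≃ {x // x ∈ Set.range f} :=
    (Equiv.ofInjective _ (Fin.castAdd_injective M K)).symm.trans (Equiv.ofInjective f hfi)
  refine ⟨e0.extendSubtype, fun i j => ?_⟩
  rw [Equiv.extendSubtype_apply_of_mem e0 _ ⟨i, rfl⟩, ← hf i j]
  have : e0 ⟨Fin.castAdd K i, ⟨i, rfl⟩⟩ = Equiv.ofInjective f hfi i := by
    simp only [e0, Equiv.trans_apply]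
    congr 1
    rw [Equiv.symm_apply_eq]
    rfl
  rw [this]
  rfl

lemma idem_zero_or_one {X : Type*} [TopologicalSpace X] {p : C(X, ℂ)} (h : p * p = p) (x : X) :
    p x = 0 ∨ p x = 1 := by
  have := congrArg (fun q : C(X, ℂ) => q x) h
  simp only [ContinuousMap.mul_apply] at this
  by_cases h0 : p x = 0
  · exact Or.inl h0
  · exact Or.inr (mul_left_cancel₀ h0 (by rw [this, mul_one]))

lemma completion_forward (M K : ℕ) (X : Type*) [TopologicalSpace X]
    (Q : Matrix (Fin (M + K)) (Fin (M + K)) C(X, ℂ)) (hQ : IsMagic Q) (x : X) :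
    (M : ℝ) - (K : ℝ) ≤ ∑ i : Fin M, ∑ j : Fin M,
      (Q (Fin.castAdd K i) (Fin.castAdd K j) x).re := by
  obtain ⟨⟨hid, -, -, -⟩, hrow, hcol⟩ := hQ
  have hnn : ∀ i j, 0 ≤ (Q i j x).re := by
    intro i j
    rcases idem_zero_or_one (hid i j) x with h | h <;> simp [h]
  have hr : ∀ i, ∑ j, (Q i j x).re = 1 := by
    intro i
    have := congrArg (fun q : C(X, ℂ) => (q x).re) (hrow i)
    simpa [ContinuousMap.sum_apply] using this
  have hc : ∀ j, ∑ i, (Q i j x).re = 1 := by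
    intro j
    have := congrArg (fun q : C(X, ℂ) => (q x).re) (hcol j)
    simpa [ContinuousMap.sum_apply] using this
  have h1 : ∑ i : Fin M, ∑ j : Fin M, (Q (Fin.castAdd K i) (Fin.castAdd K j) x).re
      + ∑ i : Fin M, ∑ k : Fin K, (Q (Fin.castAdd K i) (Fin.natAdd M k) x).re = M := by
    rw [← Finset.sum_add_distrib]
    have : ∀ i : Fin M, ∑ j : Fin M, (Q (Fin.castAdd K i) (Fin.castAdd K j) x).re
      + ∑ k : Fin K, (Q (Fin.castAdd K i) (Fin.natAdd M k) x).re = 1 := by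
      intro i
      rw [← hr (Fin.castAdd K i), Fin.sum_univ_add]
    simp [this]
  have h2 : ∑ i : Fin M, ∑ k : Fin K, (Q (Fin.castAdd K i) (Fin.natAdd M k) x).re ≤ K := by
    rw [Finset.sum_comm]
    have : ∀ k : Fin K, ∑ i : Fin M, (Q (Fin.castAdd K i) (Fin.natAdd M k) x).re ≤ 1 := by
      intro k
      have h3 := hc (Fin.natAdd M k)
      rw [Fin.sum_univ_add] at h3
      have h4 : 0 ≤ ∑ i : Fin K, (Q (Fin.natAdd M i) (Fin.natAdd M k) x).re :=
        Finset.sum_nonneg fun i _ => hnn _ _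
      linarith
    calc _ ≤ ∑ _k : Fin K, (1 : ℝ) := Finset.sum_le_sum fun k _ => this k
      _ = K := by simp
  linarith

open Classical in
lemma completion_backward (M K : ℕ) (X : Type*) [TopologicalSpace X]
    (P : Matrix (Fin M) (Fin M) C(X, ℂ)) (hP : IsSubmagic P)
    (h : ∀ x : X, (M : ℝ) - (K : ℝ) ≤ ∑ i, ∑ j, (P i j x).re) :
    ∃ Q : Matrix (Fin (M + K)) (Fin (M + K)) C(X, ℂ), IsMagic Q ∧
      ∀ i j : Fin M, Q (Fin.castAdd K i) (Fin.castAdd K j) = P i j := by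
  obtain ⟨hid, -, hrow, hcol⟩ := hP
  have h01 := fun i j x => idem_zero_or_one (hid i j) x
  let S : X → Fin M → Fin M → Prop := fun x i j => P i j x = 1
  have hS : IsLocallyConstant S := by
    rw [IsLocallyConstant.iff_eventually_eq]
    intro x
    have : ∀ i j, ∀ᶠ y in nhds x, S y i j = S x i j := by
      intro i j
      rcases h01 i j x with h0 | h1
      · have hev := (P i j).continuous.continuousAt.eventually_ne
          (show P i j x ≠ 1 by rw [h0]; exact zero_ne_one)
        filter_upwards [hev] with y hy
        simp [S, h0, hy]
      · have hev := (P i j).continuous.continuousAt.eventually_ne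
          (show P i j x ≠ 0 by rw [h1]; exact one_ne_zero)
        filter_upwards [hev] with y hy
        simp [S, h1, (h01 i j y).resolve_left hy]
    have h2 := Filter.eventually_all.2 fun i => Filter.eventually_all.2 fun j => this i j
    filter_upwards [h2] with y hy
    funext i j
    exact hy i j
  have hSr : ∀ x i j k, S x i j → S x i k → j = k := by
    intro x i j k hj hk
    by_contra hne
    have := congrArg (fun q : C(X, ℂ) => q x) (hrow i j k hne)
    simp only [ContinuousMap.mul_apply, ContinuousMap.zero_apply] at this
    simp only [S] at hj hk
    simp [hj, hk] at this
  have hSc : ∀ x i j k, S x i j → S x k j → i = k := by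
    intro x i j k hj hk
    by_contra hne
    have := congrArg (fun q : C(X, ℂ) => q x) (hcol i j k hne)
    simp only [ContinuousMap.mul_apply, ContinuousMap.zero_apply] at this
    simp only [S] at hj hk
    simp [hj, hk] at this
  have hSK : ∀ x, (Finset.univ.filter (fun i => ¬ ∃ j, S x i j)).card ≤ K := by
    intro x
    have hsum : ∀ i, ∑ j, (P i j x).re = if ∃ j, S x i j then 1 else 0 := by
      intro i
      split_ifs with hex
      · obtain ⟨j, hj⟩ := hex
        rw [Finset.sum_eq_single j]
        · simp only [S] at hj
          simp [hj]
        · intro k _ hk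
          have : P i k x = 0 := (h01 i k x).resolve_right fun h' => hk (hSr x i k j h' hj)
          simp [this]
        · simp
      · apply Finset.sum_eq_zero
        intro j _
        have : P i j x = 0 := (h01 i j x).resolve_right fun h' => hex ⟨j, h'⟩
        simp [this]
    have hx := h x
    simp only [hsum, Finset.sum_boole] at hx
    have hadd := Finset.card_filter_add_card_filter_not (s := (Finset.univ : Finset (Fin M)))
      (fun i => ∃ j, S x i j)
    rw [Finset.card_univ, Fintype.card_fin] at hadd
    have hle : (M : ℝ) ≤ ((Finset.univ.filter (fun i => ∃ j, S x i j)).card + K : ℕ) := by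
      push_cast; linarith
    have hle' := Nat.cast_le.1 hle
    omega
  let F : (Fin M → Fin M → Prop) → Equiv.Perm (Fin (M + K)) := fun s =>
    if hs : ∃ σ : Equiv.Perm (Fin (M + K)),
      ∀ i j, σ (Fin.castAdd K i) = Fin.castAdd K j ↔ s i j then hs.choose else 1
  have hF : ∀ x i j, F (S x) (Fin.castAdd K i) = Fin.castAdd K j ↔ S x i j := by
    intro x
    have hs := exists_perm_of_pattern M K (S x) (hSr x) (hSc x) (hSK x)
    simp only [F, dif_pos hs]
    exact hs.choose_spec
  let Q : Matrix (Fin (M + K)) (Fin (M + K)) C(X, ℂ) := fun i j =>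
    ⟨fun x => if F (S x) i = j then 1 else 0,
      (hS.comp (fun s => if F s i = j then (1 : ℂ) else 0)).continuous⟩
  have hQ : ∀ i j x, Q i j x = if F (S x) i = j then 1 else 0 := fun _ _ _ => rfl
  refine ⟨Q, ⟨⟨?_, ?_, ?_, ?_⟩, ?_, ?_⟩, ?_⟩
  · intro i j
    ext x
    simp [hQ]
  · intro i j
    ext x
    rw [ContinuousMap.star_apply, hQ]
    split_ifs <;> simp
  · intro i j k hjk
    ext x
    simp only [ContinuousMap.mul_apply, ContinuousMap.zero_apply, hQ]
    split_ifs with h1 h2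
    · exact absurd (h1.symm.trans h2) hjk
    all_goals simp
  · intro i j k hik
    ext x
    simp only [ContinuousMap.mul_apply, ContinuousMap.zero_apply, hQ]
    split_ifs with h1 h2
    · exact absurd ((F (S x)).injective (h1.trans h2.symm)) hik
    all_goals simp
  · intro i
    ext x
    simp [ContinuousMap.sum_apply, hQ]
  · intro j
    ext x
    simp [ContinuousMap.sum_apply, hQ, ← Equiv.eq_symm_apply]
  · intro i j
    ext x
    rw [hQ]
    simp only [hF]
    split_ifs with h1
    · exact h1.symm
    · exact ((h01 i j x).resolve_right h1).symm

/-- For a submagic matrix `P ∈ M_M(C(X,ℂ))` over a compact Hausdorff space `X`,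
`P` completes to a magic matrix in `M_{M+K}(C(X,ℂ))` iff for every `x ∈ X` the number
of pairs `(i,j)` with `P_{ij}(x) = 1` is at least `M - K`, i.e.
`∑_{ij} P_{ij}(x) ≥ M - K`. -/
theorem commutative_submagic_completion_iff (M K : ℕ) (X : Type*)
    [TopologicalSpace X] [CompactSpace X] [T2Space X]
    (P : Matrix (Fin M) (Fin M) C(X, ℂ)) (hP : IsSubmagic P) :
    (∃ Q : Matrix (Fin (M + K)) (Fin (M + K)) C(X, ℂ), IsMagic Q ∧
      ∀ i j : Fin M, Q (Fin.castAdd K i) (Fin.castAdd K j) = P i j) ↔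
    (∀ x : X, (M : ℝ) - (K : ℝ) ≤ ∑ i, ∑ j, (P i j x).re) := by
  constructor
  · rintro ⟨Q, hQ, hQP⟩ x
    simp only [← hQP]
    exact completion_forward M K X Q hQ x
  · exact completion_backward M K X P hP
end

section
/- Let σ be a partial permutation of {1,…,M} (a bijection σ : X ≃ Y with X, Y ⊆ {1,…,M}) whose domain omits at most K elements, i.e., |X^c| ≤ K. Then there exists a permutation τ of {1,…,M+K} such that for all i, j ∈ {1,…,M} one has τ(j) = i if and only if j ∈ X and σ(j) = i. -/
/-- A partial permutation `σ` of `{1,…,M}` whose domain omits at most `K` elements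
extends to a (full) permutation `τ` of `{1,…,M+K}`, in the sense that for
`i, j ∈ {1,…,M}` one has `τ(j) = i` precisely when `σ(j) = i`. -/
theorem partial_permutation_extends (M K : ℕ) (σ : Fin M ≃. Fin M)
    (h : (Finset.univ.filter fun j => σ j = none).card ≤ K) :
    ∃ τ : Equiv.Perm (Fin (M + K)),
      ∀ i j : Fin M, τ (Fin.castAdd K j) = Fin.castAdd K i ↔ σ j = some i := by
  classical
  have hc : Fintype.card {j // σ j = none} ≤ Fintype.card (Fin K) := by
    rw [Fintype.card_subtype, Fintype.card_fin]; exact h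
  obtain ⟨e⟩ := Function.Embedding.nonempty_of_card_le hc
  have hf : ∀ j : Fin M, ∃ y : Fin (M + K),
      (∀ i, σ j = some i → y = Fin.castAdd K i) ∧
      (∀ hj : σ j = none, y = Fin.natAdd M (e ⟨j, hj⟩)) := by
    intro j
    by_cases hj : σ j = none
    · exact ⟨Fin.natAdd M (e ⟨j, hj⟩), by simp [hj], fun _ => rfl⟩
    · obtain ⟨i, hi⟩ := Option.ne_none_iff_exists'.1 hj
      exact ⟨Fin.castAdd K i, by simp [hi], fun h' => absurd h' hj⟩
  choose f hf1 hf2 using hf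
  have hne : ∀ (i : Fin M) (k : Fin K), Fin.natAdd M k ≠ Fin.castAdd K i := by
    intro i k hh
    have := congrArg Fin.val hh
    simp at this
    omega
  have key : ∀ i j, f j = Fin.castAdd K i ↔ σ j = some i := by
    intro i j
    refine ⟨fun hh => ?_, hf1 j i⟩
    cases hj : σ j with
    | none => rw [hf2 j hj] at hh; exact absurd hh (hne _ _)
    | some i' =>
      rw [hf1 j i' hj] at hh
      rw [Fin.castAdd_injective M K hh]
  have finj : Function.Injective f := by
    intro a b hab
    cases ha : σ a with
    | some i =>
      have h1 := (key i a).2 ha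
      rw [hab] at h1
      exact σ.inj ha ((key i b).1 h1)
    | none =>
      cases hb : σ b with
      | some i =>
        have h1 := (key i b).2 hb
        rw [← hab, key, ha] at h1
        cases h1
      | none =>
        rw [hf2 a ha, hf2 b hb] at hab
        have := e.injective (Fin.natAdd_injective K M hab)
        exact congrArg Subtype.val this
  let E : {x // x ∈ Set.range (Fin.castAdd K : Fin M → _)} ≃ {x // x ∈ Set.range f} :=
    (Equiv.ofInjective _ (Fin.castAdd_injective M K)).symm.trans (Equiv.ofInjective f finj)
  refine ⟨E.extendSubtype, fun i j => ?_⟩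
  rw [Equiv.extendSubtype_apply_of_mem E _ ⟨j, rfl⟩, ← key]
  have : (Equiv.ofInjective _ (Fin.castAdd_injective M K)).symm ⟨Fin.castAdd K j, ⟨j, rfl⟩⟩ = j :=
    Equiv.ofInjective_symm_apply (Fin.castAdd_injective M K) j
  simp only [E, Equiv.trans_apply, this, Equiv.ofInjective_apply]
end

section
/- Let 𝖧 be a complex Hilbert space and let p, r, s, q be orthogonal projections (self-adjoint idempotent bounded operators) on 𝖧 such that the 2×2 matrix with rows (p, r) and (s, q) is submagic, i.e., p∘r = 0, s∘q = 0, p∘s = 0 and r∘q = 0. Then there exists a 4×4 magic matrix of orthogonal projections on 𝖧 whose upper-left 2×2 block has entries p, r, s, q; that is, a matrix P̃ ∈ M_4(B(𝖧)) of projections, pairwise orthogonal in each row and column, with every row and every column summing to the identity operator, and with P̃_{11} = p, P̃_{12} = r, P̃_{21} = s, P̃_{22} = q. -/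
/-- The purely algebraic completion, given a separating projection `e`. -/
theorem magic_completion {A : Type*} [Ring A] [StarRing A] (p r s q e : A)
    (hp : p * p = p) (hp' : star p = p)
    (hr : r * r = r) (hr' : star r = r)
    (hs : s * s = s) (hs' : star s = s)
    (hq : q * q = q) (hq' : star q = q)
    (he : e * e = e) (he' : star e = e)
    (hpr : p * r = 0) (hsq : s * q = 0) (hps : p * s = 0) (hrq : r * q = 0)
    (hrp : r * p = 0) (hqs : q * s = 0) (hsp : s * p = 0) (hqr : q * r = 0)
    (hep : e * p = p) (hpe : p * e = p) (heq : e * q = q) (hqe : q * e = q)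
    (her : e * r = 0) (hre : r * e = 0) (hes : e * s = 0) (hse : s * e = 0) :
    IsMagic !![p, r, e - p, 1 - e - r;
      s, q, 1 - e - s, e - q;
      1 - p - s, 0, p + s, 0;
      0, 1 - q - r, 0, q + r] := by
  refine ⟨⟨?_, ?_, ?_, ?_⟩, ?_, ?_⟩
  · intro i j
    fin_cases i <;> fin_cases j <;> simp [mul_add, add_mul, mul_sub, sub_mul, *]
  · intro i j
    fin_cases i <;> fin_cases j <;> simp [*]
  · intro i j k h
    fin_cases i <;> fin_cases j <;> fin_cases k <;> first
      | exact absurd rfl h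
      | simp [mul_add, add_mul, mul_sub, sub_mul, *]
  · intro i j k h
    fin_cases i <;> fin_cases j <;> fin_cases k <;> first
      | exact absurd rfl h
      | simp [mul_add, add_mul, mul_sub, sub_mul, *]
  · intro i
    fin_cases i <;> simp [Fin.sum_univ_four] <;> abel
  · intro i
    fin_cases i <;> simp [Fin.sum_univ_four] <;> abel

/-- Any `2×2` submagic matrix of orthogonal projections on a complex Hilbert space
completes to a `4×4` magic matrix of orthogonal projections. -/
theorem two_by_two_submagic_completes {H : Type*} [NormedAddCommGroup H]
    [InnerProductSpace ℂ H] [CompleteSpace H]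
    (p r s q : H →L[ℂ] H)
    (hp : p * p = p) (hp' : star p = p)
    (hr : r * r = r) (hr' : star r = r)
    (hs : s * s = s) (hs' : star s = s)
    (hq : q * q = q) (hq' : star q = q)
    (hpr : p * r = 0) (hsq : s * q = 0) (hps : p * s = 0) (hrq : r * q = 0) :
    ∃ Q : Matrix (Fin 4) (Fin 4) (H →L[ℂ] H), IsMagic Q ∧
      Q 0 0 = p ∧ Q 0 1 = r ∧ Q 1 0 = s ∧ Q 1 1 = q := by
  have flip : ∀ a b : H →L[ℂ] H, star a = a → star b = b → ∀ c, a * b = c → b * a = star c := by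
    intro a b ha hb c h
    rw [← h, star_mul, ha, hb]
  have hrp : r * p = 0 := by simpa using flip _ _ hp' hr' _ hpr
  have hqs : q * s = 0 := by simpa using flip _ _ hs' hq' _ hsq
  have hsp : s * p = 0 := by simpa using flip _ _ hp' hs' _ hps
  have hqr : q * r = 0 := by simpa using flip _ _ hr' hq' _ hrq
  -- the projection onto the common kernel of `r` and `s`
  let K : Submodule ℂ H := r.ker ⊓ s.ker
  have hK : IsClosed (K : Set H) := r.isClosed_ker.inter s.isClosed_ker
  haveI : CompleteSpace K := hK.completeSpace_coe
  let e : H →L[ℂ] H := K.starProjection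
  have he : e * e = e := K.isIdempotentElem_starProjection
  have he' : star e = e := isSelfAdjoint_starProjection K
  have hmem : ∀ x, r (e x) = 0 ∧ s (e x) = 0 := fun x => K.starProjection_apply_mem x
  have fix : ∀ a : H →L[ℂ] H, r * a = 0 → s * a = 0 → e * a = a := by
    intro a h1 h2
    ext x
    refine Submodule.starProjection_eq_self_iff.2 (show r (a x) = 0 ∧ s (a x) = 0 from ⟨?_, ?_⟩)
    · exact DFunLike.congr_fun h1 x
    · exact DFunLike.congr_fun h2 x
  have hep := fix p hrp hsp
  have heq := fix q hrq hsq
  have hpe : p * e = p := by simpa [hp'] using flip _ _ he' hp' _ hep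
  have hqe : q * e = q := by simpa [hq'] using flip _ _ he' hq' _ heq
  have hre : r * e = 0 := by ext x; exact (hmem x).1
  have hse : s * e = 0 := by ext x; exact (hmem x).2
  have her : e * r = 0 := by simpa using flip _ _ hr' he' _ hre
  have hes : e * s = 0 := by simpa using flip _ _ hs' he' _ hse
  exact ⟨_, magic_completion p r s q e hp hp' hr hr' hs hs' hq hq' he he' hpr hsq hps hrq
    hrp hqs hsp hqr hep hpe heq hqe her hre hes hse, rfl, rfl, rfl, rfl⟩
end

section
/- Let A be a unital C*-algebra (or a unital *-ring in which x*x = 0 implies x = 0) and let p ∈ A be a projection with p ≠ 1. Then the submagic matrix with rows (p, 0) and (0, p) admits no completion to a 3×3 magic matrix: there is no magic matrix P̃ ∈ M_3(A) with P̃_{11} = p, P̃_{22} = p, P̃_{12} = 0, P̃_{21} = 0. -/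
/-- In a unital C*-algebra, if `p` is a projection with `p ≠ 1`, then the `2×2`
submagic matrix `diag(p, p)` admits no completion to a `3×3` magic matrix. -/
theorem diag_submagic_no_three_by_three_completion {A : Type*} [NormedRing A]
    [StarRing A] [CStarRing A] [CompleteSpace A] [NormedAlgebra ℂ A] [StarModule ℂ A]
    (p : A) (hp : p * p = p) (hp' : star p = p) (hp1 : p ≠ 1) :
    ¬ ∃ Q : Matrix (Fin 3) (Fin 3) A, IsMagic Q ∧
        Q 0 0 = p ∧ Q 1 1 = p ∧ Q 0 1 = 0 ∧ Q 1 0 = 0 := by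
  rintro ⟨Q, ⟨⟨hid, _, _, hcol⟩, hrow, _⟩, h00, h11, h01, h10⟩
  have e0 := hrow 0
  have e1 := hrow 1
  rw [Fin.sum_univ_three, h00, h01, add_zero] at e0
  rw [Fin.sum_univ_three, h10, h11, zero_add] at e1
  have h : Q 0 2 = Q 1 2 := add_left_cancel (e0.trans e1.symm)
  have ho := hcol 0 2 1 (by decide)
  rw [← h, hid] at ho
  rw [ho, add_zero] at e0
  exact hp1 e0
end
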